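/- Suppose the instance satisfies the weak dominance property. Define the set B := {i ∈ {1,…,K} : for all j > i, C_j − C_i > p_{ij}} ∪ {K}. Then the minimum element of B equals the optimal arm i*. -/

import Mathlib

open MeasureTheory ProbabilityTheory

/-- The disagreement probability of two functions satisfies the triangle inequality. -/
theorem measureReal_ne_le_add {Ω α : Type*} [MeasurableSpace Ω] (P : Measure Ω)
    [IsFiniteMeasure P] (X Y Z : Ω → α) :
    P.real {ω | X ω ≠ Z ω} ≤ P.real {ω | X ω ≠ Y ω} + P.real {ω | Y ω ≠ Z ω} := by
  refine (measureReal_mono fun ω hω => ?_).trans (measureReal_union_le _ _)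
  by_contra! h
  simp_all

/-- Suppose the instance satisfies the weak dominance property
(`∀ j > i⋆, C_j − C_{i⋆} > p_{i⋆ j}`). Define
`B := {i : ∀ j > i, C_j − C_i > p_{ij}} ∪ {K}` (where `K` is the last arm of the cascade).
Then the minimum element of `B` equals the optimal arm `i⋆`. -/
theorem min_of_selection_set_eq_optimal_arm
    {Ω : Type*} [MeasurableSpace Ω] (P : Measure Ω) [IsProbabilityMeasure P]
    {n : ℕ} (Y : Ω → Bool) (Yarm : Fin (n + 1) → Ω → Bool)
    (hY : Measurable Y) (hYarm : ∀ i, Measurable (Yarm i))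
    (γ : Fin (n + 1) → ℝ) (hγ : ∀ i, γ i = (P {ω | Yarm i ω ≠ Y ω}).toReal)
    (p : Fin (n + 1) → Fin (n + 1) → ℝ)
    (hp : ∀ i j, p i j = (P {ω | Yarm i ω ≠ Yarm j ω}).toReal)
    (c : Fin (n + 1) → ℝ) (hc : ∀ i, 0 ≤ c i)
    (C : Fin (n + 1) → ℝ) (hC : ∀ i, C i = ∑ k ∈ Finset.Iic i, c k)
    (istar : Fin (n + 1))
    (hmin : ∀ i, γ istar + C istar ≤ γ i + C i)
    (hmax : ∀ i, γ i + C i = γ istar + C istar → i ≤ istar)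
    (hWD : ∀ j, istar < j → p istar j < C j - C istar) :
    IsLeast ({i : Fin (n + 1) | ∀ j, i < j → p i j < C j - C i} ∪ {Fin.last n}) istar := by
  refine ⟨Or.inl hWD, ?_⟩
  rintro i (hi | rfl)
  · by_contra! hlt
    have hgap := hi istar hlt
    have hopt := hmin i
    have htri := measureReal_ne_le_add P (Yarm i) (Yarm istar) Y
    simp only [Measure.real, ← hγ, ← hp] at htri
    linarith
  · exact Fin.le_last istar
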